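/- Let n ∈ ℕ₀ and R, S ∈ ℭ^{h=n}. If R ⊑_𝓗 S w.r.t. 𝔗_a, then R ⊑_𝓢 S w.r.t. 𝔗_a^{≈n}. Moreover, if R ⊑_𝓗 S w.r.t. the class 𝔓 of finite posets, then R ⊑_𝓢 S w.r.t. 𝔗_a^{≈n} ∩ 𝔓. -/

import Mathlib

/-- A finite digraph: a finite nonempty vertex set `V ⊆ ℕ` together with an
arc set `A ⊆ V × V`. -/
structure Dgraph where
  V : Finset ℕ
  nonempty : V.Nonempty
  A : Finset (ℕ × ℕ)
  A_sub : ∀ p ∈ A, p.1 ∈ V ∧ p.2 ∈ V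

namespace Dgraph

/-- The set of proper arcs of `G`, i.e. the arc set of `G*`. -/
def Astar (G : Dgraph) : Finset (ℕ × ℕ) := G.A.filter (fun p => p.1 ≠ p.2)

/-- `G` is reflexive. -/
def IsRefl (G : Dgraph) : Prop := ∀ v ∈ G.V, (v, v) ∈ G.A

/-- `p` is a path in `G` (a nonempty list of pairwise distinct vertices,
consecutive ones joined by arcs).  Its length as a path is `p.length - 1`. -/
def IsPath (G : Dgraph) (p : List ℕ) : Prop :=
  p ≠ [] ∧ p.Nodup ∧ (∀ v ∈ p, v ∈ G.V) ∧ p.Chain' (fun v w => (v, w) ∈ G.A)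

/-- `p` is a path in `G*`. -/
def IsPathStar (G : Dgraph) (p : List ℕ) : Prop :=
  p ≠ [] ∧ p.Nodup ∧ (∀ v ∈ p, v ∈ G.V) ∧ p.Chain' (fun v w => (v, w) ∈ G.A ∧ v ≠ w)

/-- `G*` contains a closed walk. -/
def HasClosedWalkStar (G : Dgraph) : Prop :=
  ∃ p : List ℕ, (∀ v ∈ p, v ∈ G.V) ∧ p.Chain' (fun v w => (v, w) ∈ G.A ∧ v ≠ w) ∧
    2 ≤ p.length ∧ p.head? = p.getLast?

/-- membership in the class `𝔗ₐ`: `G*` is acyclic. -/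
def MemTa (G : Dgraph) : Prop := ¬ G.HasClosedWalkStar

/-- The height of `G`: the maximal length of a path in `G`. -/
noncomputable def height (G : Dgraph) : ℕ :=
  sSup {n | ∃ p, G.IsPath p ∧ p.length = n + 1}

/-- The interval `[v,w]_G`. -/
def interval (G : Dgraph) (v w : ℕ) : Finset ℕ :=
  G.V.filter (fun z => (v, z) ∈ G.A ∧ (z, w) ∈ G.A)

/-- `ι(v,w)_G`, the cardinality of the interval `[v,w]_G`. -/
def iota (G : Dgraph) (v w : ℕ) : ℕ := (G.interval v w).card

/-- The set `𝓗(G,H)` of homomorphisms from `G` to `H` (represented as total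
maps `ℕ → ℕ`, normalized to `0` outside of `V(G)`). -/
def Hom (G H : Dgraph) : Set (ℕ → ℕ) :=
  {f | (∀ v ∈ G.V, f v ∈ H.V) ∧ (∀ p ∈ G.A, (f p.1, f p.2) ∈ H.A) ∧
    ∀ v, v ∉ G.V → f v = 0}

/-- The set `𝓢(G,H)` of strict homomorphisms from `G` to `H`. -/
def SHom (G H : Dgraph) : Set (ℕ → ℕ) :=
  {f ∈ Hom G H | ∀ p ∈ G.Astar, f p.1 ≠ f p.2}

/-- `μ_ξ(G)`, for a homomorphism `ξ` from `G` into `H`. -/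
def mu (G H : Dgraph) (f : ℕ → ℕ) : ℕ :=
  ∑ p ∈ G.Astar, H.iota (f p.1) (f p.2)

/-- `L` is a subgraph of `G`. -/
def Subgraph (L G : Dgraph) : Prop := L.V ⊆ G.V ∧ L.A ⊆ G.A

/-- Restriction of a map to a vertex set (normalized to `0` outside). -/
def restrict (X : Finset ℕ) (f : ℕ → ℕ) : ℕ → ℕ := fun x => if x ∈ X then f x else 0

/-- `𝓜(L,H)`: homomorphisms from `L` to `H` with maximal `μ`. -/
def MSet (L H : Dgraph) : Set (ℕ → ℕ) :=
  {f ∈ Hom L H | ∀ g ∈ Hom L H, mu L H g ≤ mu L H f}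

/-- `𝓜^𝓛(G,H)`. -/
def MLSet (G H : Dgraph) (𝓛 : Set Dgraph) : Set (ℕ → ℕ) :=
  {f ∈ Hom G H | ∀ L ∈ 𝓛, restrict L.V f ∈ MSet L H}

/-- `𝓙^𝓛_{G,H'}(ξ)` for `ξ ∈ 𝓗(G,H)`. -/
def JSet (G H H' : Dgraph) (𝓛 : Set Dgraph) (ξ : ℕ → ℕ) : Set (ℕ → ℕ) :=
  {ζ ∈ Hom G H' | ∀ L ∈ 𝓛, ∀ p ∈ L.Astar,
    H'.iota (ζ p.1) (ζ p.2) = H.iota (ξ p.1) (ξ p.2)}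

/-- The digraph `P_×` of a path `P = P_0, …, P_ℓ`: vertex set `{P_0,…,P_ℓ}`
and arcs `P_{i-1}P_i`. -/
def pathGraph (P : List ℕ) (h : P ≠ []) : Dgraph where
  V := P.toFinset
  nonempty := by
    obtain ⟨a, t, rfl⟩ := List.exists_cons_of_ne_nil h
    exact ⟨a, by simp⟩
  A := (P.zip P.tail).toFinset
  A_sub := by
    intro p hp
    rw [List.mem_toFinset] at hp
    have h1 := List.of_mem_zip hp
    exact ⟨List.mem_toFinset.mpr h1.1, List.mem_toFinset.mpr (List.mem_of_mem_tail h1.2)⟩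

/-- `𝓛(G)`: the set of the digraphs `P_×` for the paths `P` of length `h_G` in `G`. -/
def LSet (G : Dgraph) : Set Dgraph :=
  {D | ∃ (P : List ℕ) (h : P ≠ []), G.IsPath P ∧ P.length = G.height + 1 ∧
    D = pathGraph P h}

/-- The class `𝕽`: reflexive digraphs `R ∈ 𝔗ₐ` with
`𝓜^{𝓛(R)}(R,R) ∩ 𝓢(R,R) ≠ ∅`. -/
def MemR (R : Dgraph) : Prop :=
  R.MemTa ∧ R.IsRefl ∧ (MLSet R R (LSet R) ∩ SHom R R).Nonempty

/-- `G` is a poset: reflexive, antisymmetric and transitive. -/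
def IsPoset (G : Dgraph) : Prop :=
  G.IsRefl ∧ (∀ v w, (v, w) ∈ G.A → (w, v) ∈ G.A → v = w) ∧
    (∀ u v w, (u, v) ∈ G.A → (v, w) ∈ G.A → (u, w) ∈ G.A)

/-- The class `𝔗ₐ^{=n}`: digraphs in `𝔗ₐ` of height `n` in which every vertex
lies on a path of length `n`. -/
def MemTaEq (n : ℕ) (G : Dgraph) : Prop :=
  G.MemTa ∧ G.height = n ∧ ∀ v ∈ G.V, ∃ p, G.IsPath p ∧ p.length = n + 1 ∧ v ∈ p

/-- A maximal path in `G`: no path in `G` properly contains its vertex set. -/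
def MaximalPath (G : Dgraph) (P : List ℕ) : Prop :=
  G.IsPath P ∧ ∀ Q, G.IsPath Q → (∀ v ∈ P, v ∈ Q) → ∀ v ∈ Q, v ∈ P

end Dgraph

open Dgraph

/-- The arc relation of the transitive reduction with loops removed, `G_×`:
proper arcs `vw` of `G` admitting no path of length ≥ 2 in `G*` from `v` to `w`. -/
def RdArc (G : Dgraph) (v w : ℕ) : Prop :=
  (v, w) ∈ G.A ∧ v ≠ w ∧
    ¬ ∃ q : List ℕ, G.IsPathStar q ∧ 3 ≤ q.length ∧
      q.head? = some v ∧ q.getLast? = some w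

/-- Paths in `G_×`. -/
def IsPathx (G : Dgraph) (p : List ℕ) : Prop :=
  p ≠ [] ∧ p.Nodup ∧ (∀ v ∈ p, v ∈ G.V) ∧ p.Chain' (RdArc G)

/-- `V(G)^h`: vertices lying on a path of length `h_G`. -/
def Vh (G : Dgraph) : Set ℕ :=
  {v | ∃ p, G.IsPath p ∧ p.length = G.height + 1 ∧ v ∈ p}

/-- `V(G)^{-h} = V(G) ∖ V(G)^h`. -/
def Vmh (G : Dgraph) : Set ℕ := {v | v ∈ G.V ∧ v ∉ Vh G}

/-- `B` is a bottom shell of `v ∈ V(G)^{-h}`. -/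
def IsBottomShell (G : Dgraph) (v : ℕ) (B : Set ℕ) : Prop :=
  B ⊆ Vh G ∧
  (∀ b ∈ B, ∃ p, IsPathx G p ∧ p.head? = some b ∧ p.getLast? = some v) ∧
  (∀ p, IsPathx G p → (∃ b ∈ Vh G, p.head? = some b) → p.getLast? = some v →
    ∃ x ∈ B, x ∈ p)

/-- `U` is an upper shell of `v ∈ V(G)^{-h}`. -/
def IsUpperShell (G : Dgraph) (v : ℕ) (U : Set ℕ) : Prop :=
  U ⊆ Vh G ∧
  (∀ u ∈ U, ∃ p, IsPathx G p ∧ p.head? = some v ∧ p.getLast? = some u) ∧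
  (∀ p, IsPathx G p → p.head? = some v → (∃ u ∈ Vh G, p.getLast? = some u) →
    ∃ x ∈ U, x ∈ p)

/-- Symmetrized adjacency of `G_×` restricted to `V(G)^{-h}`. -/
def adjx (G : Dgraph) (a b : ℕ) : Prop :=
  (RdArc G a b ∨ RdArc G b a) ∧ a ∈ Vmh G ∧ b ∈ Vmh G

/-- `Z ∈ 𝓩(G)`: `Z` is a connectivity component of `G_×` restricted to
`V(G)^{-h}`. -/
def IsComponent (G : Dgraph) (Z : Set ℕ) : Prop :=
  ∃ v ∈ Vmh G, Z = {w | w ∈ Vmh G ∧ Relation.ReflTransGen (adjx G) v w}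

/-- The interval `[b,u]_{Tr(G)}` in the transitive hull of `G`. -/
def trInterval (G : Dgraph) (b u : ℕ) : Set ℕ :=
  {z | Relation.TransGen (fun a c => (a, c) ∈ G.A) b z ∧
       Relation.TransGen (fun a c => (a, c) ∈ G.A) z u}

/-- The class `𝔗ₐ^{≈n}`. -/
def MemTaApprox (n : ℕ) (G : Dgraph) : Prop :=
  G.MemTa ∧ G.height = n ∧
  ∃ B U : ℕ → Set ℕ,
    (∀ v ∈ Vmh G, IsBottomShell G v (B v) ∧ IsUpperShell G v (U v)) ∧
    ∀ Z, IsComponent G Z → ∃ b ∈ Vh G, ∃ u ∈ Vh G,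
      ((⋃ z ∈ Z, B z) ∪ Z ∪ ⋃ z ∈ Z, U z) ⊆ trInterval G b u

/-- The class `ℭ^{h=n}`: posets in which every maximal path has length `n` and
in which every interval `[v,w]` is the vertex set of a path. -/
def MemC (n : ℕ) (R : Dgraph) : Prop :=
  R.IsPoset ∧ (∀ P, MaximalPath R P → P.length = n + 1) ∧
  ∀ p ∈ R.A, ∃ q : List ℕ, R.IsPath q ∧ ∀ x, x ∈ q ↔ x ∈ R.interval p.1 p.2

/-- `rk` is a rank function with values in `{0, …, n}` on a partial order whose intervals are
chains. -/
structure IsChainGraded (n : ℕ) {α : Type*} [PartialOrder α] (rk : α → ℕ) : Prop where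
  strictMono : StrictMono rk
  rk_le (a : α) : rk a ≤ n
  covBy {a b : α} : a ⋖ b → rk b = rk a + 1
  total {a b x y : α} : x ∈ Set.Icc a b → y ∈ Set.Icc a b → x ≤ y ∨ y ≤ x

namespace IsChainGraded

variable {n : ℕ} {α : Type*} [PartialOrder α] {rk : α → ℕ}

theorem lt_of_rk_lt (h : IsChainGraded n rk) {a b x y : α} (hx : x ∈ Set.Icc a b)
    (hy : y ∈ Set.Icc a b) (hxy : rk x < rk y) : x < y := by
  rcases h.total hx hy with hle | hle
  · exact lt_of_le_of_ne hle fun e => hxy.ne (e ▸ rfl)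
  · exact absurd (h.strictMono.monotone hle) hxy.not_ge

theorem eq_of_rk_eq (h : IsChainGraded n rk) {a b x y : α} (hx : x ∈ Set.Icc a b)
    (hy : y ∈ Set.Icc a b) (hxy : rk x = rk y) : x = y := by
  by_contra hne
  rcases h.total hx hy with hle | hle
  · exact (h.strictMono (lt_of_le_of_ne hle hne)).ne hxy
  · exact (h.strictMono (lt_of_le_of_ne hle (Ne.symm hne))).ne hxy.symm

theorem exists_rk_eq [Finite α] (h : IsChainGraded n rk) {a b : α} (hab : a ≤ b) {r : ℕ}
    (har : rk a ≤ r) (hrb : r ≤ rk b) : ∃ x ∈ Set.Icc a b, rk x = r := by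
  obtain ⟨m, hm⟩ := Nat.exists_eq_add_of_le hrb
  induction m generalizing b with
  | zero => exact ⟨b, ⟨hab, le_rfl⟩, by omega⟩
  | succ m ih =>
    have hlt : a < b := lt_of_le_of_ne hab fun e => by subst e; omega
    obtain ⟨c, hac, hcb⟩ := exists_le_covBy_of_lt hlt
    have hc := h.covBy hcb
    obtain ⟨x, hx, hxr⟩ := ih hac (by omega) (by omega)
    exact ⟨x, ⟨hx.1, hx.2.trans hcb.le⟩, hxr⟩

theorem card_Icc [Finite α] (h : IsChainGraded n rk) {a b : α} (hab : a ≤ b) :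
    Nat.card (Set.Icc a b) = rk b - rk a + 1 := by
  have e : Set.Icc a b ≃ Set.Icc (rk a) (rk b) :=
    Equiv.ofBijective
      (fun x => ⟨rk x, h.strictMono.monotone x.2.1, h.strictMono.monotone x.2.2⟩)
      ⟨fun x y hxy => Subtype.ext (h.eq_of_rk_eq x.2 y.2 (congrArg Subtype.val hxy)), fun r => by
        obtain ⟨x, hx, hxr⟩ := h.exists_rk_eq hab r.2.1 r.2.2
        exact ⟨⟨x, hx⟩, Subtype.ext hxr⟩⟩
  have := h.strictMono.monotone hab
  rw [Nat.card_congr e, Nat.card_eq_fintype_card, Fintype.card_ofFinset, Nat.card_Icc]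
  omega

end IsChainGraded

section Flags

variable {α : Type*} [PartialOrder α]

/-- The part of the flag `F` below `x`, continued by the part of the flag `F'` above `x`. -/
def Flag.splice (F F' : Flag α) (x : α) (hx : x ∈ F) (hx' : x ∈ F') : Flag α :=
  Flag.ofIsMaxChain ({z | z ∈ F ∧ z ≤ x} ∪ {z | z ∈ F' ∧ x ≤ z}) <| by
    refine ⟨?_, fun t ht hst => hst.antisymm fun z hz => ?_⟩
    · rintro y (⟨hy, hyx⟩ | ⟨hy, hyx⟩) z (⟨hz, hzx⟩ | ⟨hz, hzx⟩) -
      · exact F.le_or_le hy hz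
      · exact Or.inl (hyx.trans hzx)
      · exact Or.inr (hzx.trans hyx)
      · exact F'.le_or_le hy hz
    · rcases ht.total hz (hst (Or.inl ⟨hx, le_rfl⟩)) with hzx | hzx
      · refine Or.inl ⟨Flag.mem_iff_forall_le_or_ge.2 fun b hb => ?_, hzx⟩
        rcases F.le_or_le hb hx with hbx | hbx
        · exact ht.total hz (hst (Or.inl ⟨hb, hbx⟩))
        · exact Or.inl (hzx.trans hbx)
      · refine Or.inr ⟨Flag.mem_iff_forall_le_or_ge.2 fun b hb => ?_, hzx⟩
        rcases F'.le_or_le hb hx' with hbx | hbx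
        · exact Or.inr (hbx.trans hzx)
        · exact ht.total hz (hst (Or.inr ⟨hb, hbx⟩))

variable [Finite α] {n : ℕ}

theorem Flag.ncard_lt_add_ncard_ge (hn : ∀ F : Flag α, (F : Set α).ncard = n + 1)
    {F F' : Flag α} {x : α} (hx : x ∈ F) (hx' : x ∈ F') :
    {z | z ∈ F ∧ z < x}.ncard + {z | z ∈ F' ∧ x ≤ z}.ncard = n + 1 := by
  rw [← hn (F.splice F' x hx hx'), ← Set.ncard_union_eq]
  · congr 1
    ext z
    simp only [Flag.splice, Set.mem_union, Set.mem_ofPred_eq]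
    constructor
    · rintro (⟨h, h'⟩ | h)
      · exact Or.inl ⟨h, h'.le⟩
      · exact Or.inr h
    · rintro (⟨h, h'⟩ | h)
      · rcases h'.lt_or_eq with h' | rfl
        · exact Or.inl ⟨h, h'⟩
        · exact Or.inr ⟨hx', le_rfl⟩
      · exact Or.inr h
  · exact Set.disjoint_left.2 fun z hz hz' => hz.2.not_ge hz'.2

theorem exists_isChainGraded (hn : ∀ F : Flag α, (F : Set α).ncard = n + 1)
    (htotal : ∀ {a b x y : α}, x ∈ Set.Icc a b → y ∈ Set.Icc a b → x ≤ y ∨ y ≤ x) :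
    ∃ rk : α → ℕ, IsChainGraded n rk := by
  have hex : ∀ x : α, ∃ F : Flag α, x ∈ F := fun x => by
    obtain ⟨F, hF⟩ := (IsChain.singleton (r := (· ≤ ·)) (a := x)).exists_subset_flag
    exact ⟨F, hF rfl⟩
  choose F₀ hF₀ using hex
  have hrk : ∀ {x : α} {F : Flag α}, x ∈ F →
      {z | z ∈ F₀ x ∧ z < x}.ncard = {z | z ∈ F ∧ z < x}.ncard := fun {x F} hx => by
    have h₁ := Flag.ncard_lt_add_ncard_ge hn (hF₀ x) hx
    have h₂ := Flag.ncard_lt_add_ncard_ge hn hx hx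
    omega
  refine ⟨fun x => {z | z ∈ F₀ x ∧ z < x}.ncard, fun x y hxy => ?_, fun x => ?_,
    fun {x y} hxy => ?_, htotal⟩
  · obtain ⟨F, hF⟩ := (IsChain.pair (r := (· ≤ ·)) hxy.le).exists_subset_flag
    have hxF : x ∈ F := hF (by simp)
    simp only [hrk hxF, hrk (hF (by simp) : y ∈ F)]
    refine Set.ncard_lt_ncard ⟨fun z hz => ⟨hz.1, hz.2.trans hxy⟩, fun h => ?_⟩
    exact lt_irrefl x (h ⟨hxF, hxy⟩).2
  · have h₁ := Flag.ncard_lt_add_ncard_ge hn (hF₀ x) (hF₀ x)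
    have h₂ : 0 < {z | z ∈ F₀ x ∧ x ≤ z}.ncard :=
      (Set.ncard_pos (Set.toFinite _)).2 ⟨x, hF₀ x, le_rfl⟩
    omega
  · obtain ⟨F, hF⟩ := (IsChain.pair (r := (· ≤ ·)) hxy.le).exists_subset_flag
    have hxF : x ∈ F := hF (by simp)
    simp only [hrk hxF, hrk (hF (by simp) : y ∈ F)]
    rw [← Set.ncard_insert_of_notMem (a := x) (fun h => lt_irrefl x h.2)]
    congr 1
    ext z
    simp only [Set.mem_ofPred_eq, Set.mem_insert_iff]
    constructor
    · rintro ⟨hz, hzy⟩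
      rcases F.le_or_le hz hxF with hzx | hxz
      · exact hzx.eq_or_lt.imp_right fun h => ⟨hz, h⟩
      · exact hxz.eq_or_lt.imp Eq.symm fun h => absurd hzy (hxy.2 h)
    · rintro (rfl | ⟨hz, hzx⟩)
      · exact ⟨hxF, hxy.lt⟩
      · exact ⟨hz, hzx.trans hxy.lt⟩

end Flags

section Counting

open Filter Topology

theorem tendsto_sum_pow_atTop_card {ι : Type*} [Fintype ι] (x : ι → ℝ) (h₀ : ∀ i, 0 ≤ x i)
    (h₁ : ∀ i, x i ≤ 1) :
    Tendsto (fun k : ℕ => ∑ i, x i ^ k) atTop (𝓝 (Nat.card {i // x i = 1} : ℝ)) := by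
  classical
  have : (Nat.card {i // x i = 1} : ℝ) = ∑ i, if x i = 1 then 1 else 0 := by
    simp [Nat.card_eq_fintype_card, Fintype.card_subtype]
  rw [this]
  refine tendsto_finsetSum _ fun i _ => ?_
  split_ifs with h
  · exact tendsto_const_nhds.congr fun k => by rw [h, one_pow]
  · exact tendsto_pow_atTop_nhds_zero_of_lt_one (h₀ i) (lt_of_le_of_ne (h₁ i) h)

theorem tendsto_sum_div_pow_atTop_card {ι : Type*} [Fintype ι] {M : ℕ} (hM : 0 < M) (a : ι → ℕ)
    (ha : ∀ i, a i ≤ M) :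
    Tendsto (fun k : ℕ => ∑ i, ((a i : ℝ) / M) ^ k) atTop (𝓝 (Nat.card {i // a i = M} : ℝ)) := by
  have hM' : (0 : ℝ) < M := by exact_mod_cast hM
  have := tendsto_sum_pow_atTop_card (fun i => (a i : ℝ) / M) (fun i => by positivity)
    fun i => (div_le_one hM').2 (by exact_mod_cast ha i)
  simpa only [div_eq_one_iff_eq hM'.ne', Nat.cast_inj] using this

theorem card_eq_max_le_of_sum_pow_le {ι κ : Type*} [Fintype ι] [Fintype κ] {M : ℕ} (hM : 0 < M)
    (a : ι → ℕ) (b : κ → ℕ) (ha : ∀ i, a i ≤ M) (hb : ∀ i, b i ≤ M)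
    (h : ∀ k : ℕ, ∑ i, a i ^ k ≤ ∑ i, b i ^ k) :
    Nat.card {i // a i = M} ≤ Nat.card {i // b i = M} := by
  have hle := le_of_tendsto_of_tendsto' (tendsto_sum_div_pow_atTop_card hM a ha)
    (tendsto_sum_div_pow_atTop_card hM b hb) fun k => by
      simp only [div_pow, ← Finset.sum_div]
      gcongr
      exact_mod_cast h k
  exact_mod_cast hle

theorem prod_add_one_le_two_pow {ι : Type*} [Fintype ι] {a : ι → ℕ}
    (h : ∑ i, a i ≤ Fintype.card ι) : ∏ i, (a i + 1) ≤ 2 ^ Fintype.card ι :=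
  calc ∏ i, (a i + 1) ≤ ∏ i, 2 ^ a i := Finset.prod_le_prod' fun i _ => (a i).lt_two_pow_self
    _ = 2 ^ ∑ i, a i := Finset.prod_pow_eq_pow_sum _ _ _
    _ ≤ 2 ^ Fintype.card ι := Nat.pow_le_pow_right two_pos h

theorem prod_add_one_eq_two_pow_iff {ι : Type*} [Fintype ι] {a : ι → ℕ}
    (h : ∑ i, a i ≤ Fintype.card ι) :
    ∏ i, (a i + 1) = 2 ^ Fintype.card ι ↔ ∀ i, a i = 1 := by
  refine ⟨fun he => ?_, fun h => by simp [h]⟩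
  have hle : ∀ i, a i ≤ 1 := by
    by_contra! hi
    obtain ⟨i, hi⟩ := hi
    have hlt : ∏ i, (a i + 1) < ∏ i, 2 ^ a i :=
      Finset.prod_lt_prod (fun _ _ => Nat.succ_pos _) (fun i _ => (a i).lt_two_pow_self)
        ⟨i, Finset.mem_univ i, by
          obtain ⟨m, hm⟩ := Nat.exists_eq_add_of_le hi
          have := m.lt_two_pow_self
          rw [hm, pow_add]
          omega⟩
    rw [Finset.prod_pow_eq_pow_sum, he] at hlt
    exact absurd (Nat.pow_le_pow_right two_pos h) hlt.not_ge
  have hsum : ∑ i, a i = ∑ _i : ι, 1 := by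
    refine le_antisymm (by simpa using h) ?_
    have : 2 ^ Fintype.card ι ≤ 2 ^ ∑ i, a i := by
      rw [← he, ← Finset.prod_pow_eq_pow_sum]
      exact Finset.prod_le_prod' fun i _ => (a i).lt_two_pow_self
    simpa using (Nat.pow_le_pow_iff_right one_lt_two).1 this
  exact fun i => (Finset.sum_eq_sum_iff_of_le fun i _ => hle i).1 hsum i (Finset.mem_univ i)

theorem sum_tsub_succ_of_monotone {n : ℕ} {f : Fin (n + 1) → ℕ} (hf : Monotone f) :
    ∑ i : Fin n, (f i.succ - f i.castSucc) = f (Fin.last n) - f 0 := by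
  induction n with
  | zero => simp
  | succ n ih =>
    have := ih (f := fun i => f i.castSucc) fun i j hij => hf (by simpa using hij)
    have h₁ := hf (Fin.zero_le (Fin.last n).castSucc)
    have h₂ := hf (Fin.le_last (Fin.last n).castSucc)
    simp only [Fin.castSucc_zero] at this
    rw [Fin.sum_univ_castSucc]
    simp only [Fin.succ_castSucc, this, Fin.succ_last, Nat.succ_eq_add_one]
    omega

theorem StrictMono.eq_val_of_le {n : ℕ} {f : Fin (n + 1) → ℕ} (hf : StrictMono f)
    (hn : ∀ i, f i ≤ n) (i : Fin (n + 1)) : f i = i := by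
  have lower : ∀ {g : Fin (n + 1) → ℕ}, StrictMono g → ∀ i : Fin (n + 1), (i : ℕ) ≤ g i :=
      fun {g} hg i => by
    induction i using Fin.induction with
    | zero => simp
    | succ i ih =>
      have := hg i.castSucc_lt_succ
      simp only [Fin.val_castSucc, Fin.val_succ] at ih ⊢
      omega
  have h₁ := lower hf i
  have h₂ := lower (g := fun j => n - f j.rev) (fun j k hjk => by
    have := hf (Fin.rev_lt_rev.2 hjk)
    have := hn k.rev
    have := hn j.rev
    show n - f j.rev < n - f k.rev
    omega) i.rev
  rw [Fin.rev_rev, Fin.val_rev] at h₂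
  have := hn i
  omega

end Counting

section Subdivision

/-- The partial order obtained from `H` by adding, for each `j : J`, a new element between `s j`
and `t j`. -/
def Subdivision {H J : Type*} [PartialOrder H] (s t : J → H) (_ : ∀ j, s j < t j) : Type _ :=
  H ⊕ J

namespace Subdivision

variable {H J : Type*} [PartialOrder H] {s t : J → H} {hst : ∀ j, s j < t j}

/-- The order relation of `Subdivision s t hst`. -/
def Rel (s t : J → H) : H ⊕ J → H ⊕ J → Prop
  | Sum.inl x, Sum.inl y => x ≤ y
  | Sum.inl x, Sum.inr j => x ≤ s j
  | Sum.inr i, Sum.inl y => t i ≤ y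
  | Sum.inr i, Sum.inr j => i = j ∨ t i ≤ s j

instance : PartialOrder (Subdivision s t hst) where
  le := Rel s t
  le_refl a := by
    rcases a with x | i
    · exact le_refl x
    · exact Or.inl rfl
  le_trans a b c hab hbc := by
    rcases a with x | i <;> rcases b with y | j <;> rcases c with z | k
    · exact le_trans (α := H) hab hbc
    · exact le_trans (α := H) hab hbc
    · exact le_trans (α := H) hab ((hst j).le.trans hbc)
    · rcases hbc with rfl | hbc
      · exact hab
      · exact le_trans (α := H) hab ((hst j).le.trans hbc)
    · exact le_trans (α := H) hab hbc
    · exact Or.inr (le_trans (α := H) hab hbc)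
    · rcases hab with rfl | hab
      · exact hbc
      · exact le_trans (α := H) hab ((hst j).le.trans hbc)
    · rcases hab with rfl | hab
      · exact hbc
      · rcases hbc with rfl | hbc
        · exact Or.inr hab
        · exact Or.inr (hab.trans ((hst j).le.trans hbc))
  le_antisymm a b hab hba := by
    rcases a with x | i <;> rcases b with y | j
    · exact congrArg Sum.inl (le_antisymm (α := H) hab hba)
    · exact absurd (lt_of_le_of_lt (α := H) hab (hst j)) (not_lt_of_ge hba)
    · exact absurd (lt_of_le_of_lt (α := H) hba (hst i)) (not_lt_of_ge hab)
    · rcases hab with rfl | hab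
      · rfl
      · rcases hba with rfl | hba
        · rfl
        · exact absurd ((hab.trans_lt (hst j)).trans_le hba) (hst i).not_gt

instance [Finite H] [Finite J] : Finite (Subdivision s t hst) :=
  inferInstanceAs (Finite (H ⊕ J))

instance [Nonempty H] : Nonempty (Subdivision s t hst) :=
  inferInstanceAs (Nonempty (H ⊕ J))

/-- A monotone map on the subdivision is a monotone map on `H` together with the choice of an
image for every new element. -/
def orderHomEquiv {α : Type*} [PartialOrder α] :
    (Subdivision s t hst →o α) ≃
      Σ ξ : H →o α, ∀ j, Set.Icc (ξ (s j)) (ξ (t j)) where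
  toFun f := ⟨⟨fun x => f (Sum.inl x), fun x y hxy => f.monotone (show Rel s t _ _ from hxy)⟩,
    fun j => ⟨f (Sum.inr j), f.monotone (show Rel s t _ _ from le_refl (s j)),
      f.monotone (show Rel s t _ _ from le_refl (t j))⟩⟩
  invFun g := ⟨fun a => Sum.elim g.1 (fun j => (g.2 j : α)) a, fun a b hab => by
    rcases a with x | i <;> rcases b with y | j
    · exact g.1.monotone hab
    · exact (g.1.monotone hab).trans (g.2 j).2.1
    · exact (g.2 i).2.2.trans (g.1.monotone hab)
    · rcases hab with rfl | hab
      · exact le_rfl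
      · exact (g.2 i).2.2.trans ((g.1.monotone hab).trans (g.2 j).2.1)⟩
  left_inv f := by
    ext a
    rcases a with x | i <;> rfl
  right_inv g := rfl

end Subdivision

end Subdivision

section StrictMonoCount

variable {n : ℕ}

theorem IsChainGraded.rk_apply_chain {α : Type*} [PartialOrder α] {rk : α → ℕ}
    (hα : IsChainGraded n rk) {p : Fin (n + 1) → α} (hp : StrictMono p) (i : Fin (n + 1)) :
    rk (p i) = i :=
  (hα.strictMono.comp hp).eq_val_of_le (fun _ => hα.rk_le _) i

variable {H : Type*} [PartialOrder H]

/-- The steps of the chains of length `n` in `H`. -/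
abbrev ChainStep (n : ℕ) (H : Type*) [PartialOrder H] : Type _ :=
  {p : Fin (n + 1) → H // StrictMono p} × Fin n

/-- The lower end of a step of a chain. -/
def ChainStep.source (c : ChainStep n H) : H := c.1.1 c.2.castSucc

/-- The upper end of a step of a chain. -/
def ChainStep.target (c : ChainStep n H) : H := c.1.1 c.2.succ

theorem ChainStep.source_lt_target (c : ChainStep n H) : c.source < c.target :=
  c.1.2 c.2.castSucc_lt_succ

namespace IsChainGraded

variable {α : Type*} [PartialOrder α] {rk : α → ℕ}

theorem sum_chainStep_le [Fintype {p : Fin (n + 1) → H // StrictMono p}]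
    (hα : IsChainGraded n rk) (ξ : H →o α) :
    ∑ c : ChainStep n H, (rk (ξ c.target) - rk (ξ c.source)) ≤ Fintype.card (ChainStep n H) := by
  rw [Fintype.sum_prod_type, Fintype.card_prod, Fintype.card_fin, ← smul_eq_mul,
    ← Finset.card_univ]
  refine Finset.sum_le_card_nsmul _ _ _ fun p _ => ?_
  have := sum_tsub_succ_of_monotone (hα.strictMono.monotone.comp (ξ.monotone.comp p.2.monotone))
  exact this.trans_le ((Nat.sub_le _ _).trans (hα.rk_le _))

theorem card_subdivision_orderHom [Finite α]
    [Fintype {p : Fin (n + 1) → H // StrictMono p}] [Fintype (H →o α)]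
    (hα : IsChainGraded n rk) (k : ℕ) :
    Nat.card (Subdivision (fun c : ChainStep n H × Fin k => c.1.source) (fun c => c.1.target)
        (fun c => c.1.source_lt_target) →o α) =
      ∑ ξ : H →o α, (∏ c : ChainStep n H, (rk (ξ c.target) - rk (ξ c.source) + 1)) ^ k := by
  rw [Nat.card_congr Subdivision.orderHomEquiv, Nat.card_sigma]
  refine Finset.sum_congr rfl fun ξ _ => ?_
  rw [Nat.card_pi, Fintype.prod_prod_type, ← Finset.prod_pow]
  refine Finset.prod_congr rfl fun c _ => ?_
  simp [hα.card_Icc (ξ.monotone c.source_lt_target.le)]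

theorem rk_comp_eq (hα : IsChainGraded n rk) (hcov : ∀ x : H, ∃ p : Fin (n + 1) → H,
      StrictMono p ∧ x ∈ Set.range p) {pos : H → ℕ} (hpos : StrictMono pos)
    (hposn : ∀ x, pos x ≤ n) {f : H → α}
    (hf : ∀ p : Fin (n + 1) → H, StrictMono p → StrictMono (f ∘ p)) (x : H) :
    rk (f x) = pos x := by
  obtain ⟨p, hp, i, rfl⟩ := hcov x
  exact (hα.rk_apply_chain (hf p hp) i).trans
    ((hpos.comp hp).eq_val_of_le (fun _ => hposn _) i).symm

theorem card_prod_eq_max [Fintype {p : Fin (n + 1) → H // StrictMono p}] (hα : IsChainGraded n rk)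
    (hcov : ∀ x : H, ∃ p : Fin (n + 1) → H, StrictMono p ∧ x ∈ Set.range p) {pos : H → ℕ}
    (hpos : StrictMono pos) (hposn : ∀ x, pos x ≤ n) :
    Nat.card {ξ : H →o α // ∏ c : ChainStep n H, (rk (ξ c.target) - rk (ξ c.source) + 1) =
        2 ^ Fintype.card (ChainStep n H)} =
      Nat.card {f : H → α // StrictMono f} := by
  refine Nat.card_congr
    { toFun := fun ξ => ⟨ξ.1, fun x y hxy => ?_⟩
      invFun := fun f => ⟨⟨f.1, f.2.monotone⟩, ?_⟩
      left_inv := fun _ => rfl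
      right_inv := fun _ => rfl }
  · have hξ := (prod_add_one_eq_two_pow_iff (hα.sum_chainStep_le ξ.1)).1 ξ.2
    have hrk := hα.rk_comp_eq hcov hpos hposn (f := ξ.1) fun p hp =>
      Fin.strictMono_iff_lt_succ.2 fun i => by
        have h₁ : rk (ξ.1 (p i.succ)) - rk (ξ.1 (p i.castSucc)) = 1 := hξ (⟨p, hp⟩, i)
        refine lt_of_le_of_ne (ξ.1.monotone (hp i.castSucc_lt_succ).le) fun h => ?_
        simp only [Function.comp_apply] at h
        rw [h] at h₁
        omega
    refine lt_of_le_of_ne (ξ.1.monotone hxy.le) fun h => (hpos hxy).ne ?_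
    rw [← hrk, ← hrk, h]
  · refine (prod_add_one_eq_two_pow_iff (hα.sum_chainStep_le ⟨f.1, f.2.monotone⟩)).2 fun c => ?_
    have h₁ := hα.rk_apply_chain (f.2.comp c.1.2) c.2.castSucc
    have h₂ := hα.rk_apply_chain (f.2.comp c.1.2) c.2.succ
    simp only [Function.comp_apply, Fin.val_castSucc, Fin.val_succ] at h₁ h₂
    show rk (f.1 (c.1.1 c.2.succ)) - rk (f.1 (c.1.1 c.2.castSucc)) = 1
    omega

end IsChainGraded

theorem card_strictMono_le_of_card_orderHom_le {H α β : Type} [PartialOrder H] [Finite H]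
    [Nonempty H] [PartialOrder α] [Finite α] [PartialOrder β] [Finite β] {rkα : α → ℕ}
    {rkβ : β → ℕ} (hα : IsChainGraded n rkα) (hβ : IsChainGraded n rkβ)
    (hle : ∀ (P : Type) [PartialOrder P] [Finite P] [Nonempty P],
      Nat.card (P →o α) ≤ Nat.card (P →o β))
    (hcov : ∀ x : H, ∃ p : Fin (n + 1) → H, StrictMono p ∧ x ∈ Set.range p) {pos : H → ℕ}
    (hpos : StrictMono pos) (hposn : ∀ x, pos x ≤ n) :
    Nat.card {f : H → α // StrictMono f} ≤ Nat.card {f : H → β // StrictMono f} := by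
  have := Fintype.ofFinite {p : Fin (n + 1) → H // StrictMono p}
  have : Finite (H →o α) := Finite.of_injective _ DFunLike.coe_injective
  have : Finite (H →o β) := Finite.of_injective _ DFunLike.coe_injective
  have := Fintype.ofFinite (H →o α)
  have := Fintype.ofFinite (H →o β)
  rw [← hα.card_prod_eq_max hcov hpos hposn, ← hβ.card_prod_eq_max hcov hpos hposn]
  refine card_eq_max_le_of_sum_pow_le (by positivity) _ _
    (fun ξ => prod_add_one_le_two_pow (hα.sum_chainStep_le ξ))
    (fun ξ => prod_add_one_le_two_pow (hβ.sum_chainStep_le ξ)) fun k => ?_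
  rw [← hα.card_subdivision_orderHom k, ← hβ.card_subdivision_orderHom k]
  exact hle _

end StrictMonoCount

section Fibres

variable {n : ℕ} {γ : Type*} [PartialOrder γ] [Finite γ] {X : Set γ}

theorem strictMono_of_forall_covBy {α : Type*} [Preorder α] {f : γ → α}
    (h : ∀ a c, a ⋖ c → f a < f c) : StrictMono f := fun a c hac => by
  classical
  have := Fintype.ofFinite γ
  let _ : LocallyFiniteOrder γ := Fintype.toLocallyFiniteOrder
  have hgen := transGen_covBy_of_lt hac
  induction hgen with
  | single hab => exact h _ _ hab
  | tail hab hbc ih => exact (ih (lt_iff_transGen_covBy.2 hab)).trans (h _ _ hbc)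

/-- Every element outside of `X` lies in an interval `[b z, u z]` with end points in `X`, such that
these intervals are compatible with the covering relation. -/
structure IntervalCover (X : Set γ) (b u : γ → X) : Prop where
  mem_Icc {z : γ} : z ∉ X → z ∈ Set.Icc (b z : γ) (u z)
  eq_of_covBy {a c : γ} : a ⋖ c → a ∉ X → c ∉ X → b a = b c ∧ u a = u c
  upper_mem {a c : γ} : a ⋖ c → a ∉ X → c ∈ X → c ∈ Set.Icc (b a : γ) (u a)
  lower_mem {a c : γ} : a ⋖ c → a ∈ X → c ∉ X → a ∈ Set.Icc (b c : γ) (u c)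

namespace IntervalCover

variable {α : Type*} [PartialOrder α] {rk : α → ℕ} {b u : γ → X}

theorem exists_extension [Finite α] (hX : IntervalCover X b u) (hα : IsChainGraded n rk)
    {η : X → α} (hη : StrictMono η) {ρ : γ → ℕ} (hρ : StrictMono ρ)
    (hηρ : ∀ x, rk (η x) = ρ x) :
    ∃ f : γ → α, StrictMono f ∧ (∀ x : X, f x = η x) ∧ ∀ z, rk (f z) = ρ z := by
  have hex : ∀ z, ∃ y, rk y = ρ z ∧ (∀ hz : z ∈ X, y = η ⟨z, hz⟩) ∧
      (z ∉ X → y ∈ Set.Icc (η (b z)) (η (u z))) := fun z => by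
    by_cases hz : z ∈ X
    · exact ⟨η ⟨z, hz⟩, hηρ _, fun _ => rfl, fun h => absurd hz h⟩
    · have hm := hX.mem_Icc hz
      have hbu : b z ≤ u z := Subtype.coe_le_coe.1 (hm.1.trans hm.2)
      obtain ⟨y, hy, hyr⟩ := hα.exists_rk_eq (hη.monotone hbu) (r := ρ z)
        ((hηρ _).trans_le (hρ.monotone hm.1)) ((hρ.monotone hm.2).trans_eq (hηρ _).symm)
      exact ⟨y, hyr, fun h => absurd h hz, fun _ => hy⟩
  choose f hfρ hfη hfI using hex
  refine ⟨f, strictMono_of_forall_covBy fun a c hac => ?_, fun x => hfη x x.2, hfρ⟩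
  have hlt : rk (f a) < rk (f c) := by
    rw [hfρ, hfρ]
    exact hρ hac.lt
  have hηI : ∀ {x : γ} (hx : x ∈ X) {l r : X}, x ∈ Set.Icc (l : γ) r →
      f x ∈ Set.Icc (η l) (η r) := fun hx l r h => by
    rw [hfη _ hx]
    exact ⟨hη.monotone h.1, hη.monotone h.2⟩
  by_cases ha : a ∈ X <;> by_cases hc : c ∈ X
  · rw [hfη a ha, hfη c hc]
    exact hη hac.lt
  · exact hα.lt_of_rk_lt (hηI ha (hX.lower_mem hac ha hc)) (hfI c hc) hlt
  · exact hα.lt_of_rk_lt (hfI a ha) (hηI hc (hX.upper_mem hac ha hc)) hlt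
  · obtain ⟨hb, hu⟩ := hX.eq_of_covBy hac ha hc
    exact hα.lt_of_rk_lt (hfI a ha) (hb ▸ hu ▸ hfI c hc) hlt

theorem card_strictMono_eq_mul [Finite α] (hX : IntervalCover X b u)
    (hα : IsChainGraded n rk)
    (hcov : ∀ x : X, ∃ p : Fin (n + 1) → X, StrictMono p ∧ x ∈ Set.range p) :
    Nat.card {f : γ → α // StrictMono f} =
      Nat.card {η : X → α // StrictMono η} *
        Nat.card {ρ : γ → ℕ // StrictMono ρ ∧ ∀ v, ρ v ≤ n} := by
  rw [← Nat.card_prod]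
  refine Nat.card_congr (Equiv.ofBijective
    (fun f => (⟨fun x => f.1 x, fun x y hxy => f.2 hxy⟩,
      ⟨fun z => rk (f.1 z), hα.strictMono.comp f.2, fun _ => hα.rk_le _⟩)) ⟨?_, ?_⟩)
  · intro f g hfg
    have hη : ∀ x : X, f.1 x = g.1 x := congrFun (congrArg (fun h => h.1.1) hfg)
    have hρ : ∀ z, rk (f.1 z) = rk (g.1 z) := congrFun (congrArg (fun h => h.2.1) hfg)
    refine Subtype.ext (funext fun z => ?_)
    by_cases hz : z ∈ X
    · exact hη ⟨z, hz⟩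
    · have hm := hX.mem_Icc hz
      refine hα.eq_of_rk_eq (a := f.1 (b z)) (b := f.1 (u z))
        ⟨f.2.monotone hm.1, f.2.monotone hm.2⟩ ?_ (hρ z)
      rw [hη, hη]
      exact ⟨g.2.monotone hm.1, g.2.monotone hm.2⟩
  · rintro ⟨⟨η, hη⟩, ρ, hρ, hρn⟩
    obtain ⟨f, hf, hfη, hfρ⟩ := hX.exists_extension hα hη hρ
      (hα.rk_comp_eq hcov (pos := fun x : X => ρ x) (fun x y hxy => hρ hxy) (fun _ => hρn _)
        fun p hp => hη.comp hp)
    exact ⟨⟨f, hf⟩, Prod.ext (Subtype.ext (funext hfη)) (Subtype.ext (funext hfρ))⟩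

end IntervalCover

theorem IntervalCover.card_strictMono_le {γ α β : Type} [PartialOrder γ] [Finite γ] [Nonempty γ]
    [PartialOrder α] [Finite α] [PartialOrder β] [Finite β] {rkα : α → ℕ} {rkβ : β → ℕ}
    {X : Set γ} {b u : γ → X} (hX : IntervalCover X b u)
    (hα : IsChainGraded n rkα) (hβ : IsChainGraded n rkβ)
    (hle : ∀ (P : Type) [PartialOrder P] [Finite P] [Nonempty P],
      Nat.card (P →o α) ≤ Nat.card (P →o β))
    (hcov : ∀ x : X, ∃ p : Fin (n + 1) → X, StrictMono p ∧ x ∈ Set.range p) :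
    Nat.card {f : γ → α // StrictMono f} ≤ Nat.card {f : γ → β // StrictMono f} := by
  rcases isEmpty_or_nonempty {f : γ → α // StrictMono f} with _ | ⟨⟨f, hf⟩⟩
  · simp
  · have : Nonempty X := ‹Nonempty γ›.map b
    rw [hX.card_strictMono_eq_mul hα hcov, hX.card_strictMono_eq_mul hβ hcov]
    exact Nat.mul_le_mul_right _ <|
      card_strictMono_le_of_card_orderHom_le hα hβ hle hcov (pos := fun x : X => rkα (f x))
        (fun x y hxy => hα.strictMono (hf hxy)) fun _ => hα.rk_le _

end Fibres

namespace Dgraph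

/-- A vertex of a digraph. -/
@[ext]
structure Vertex (G : Dgraph) where
  /-- The underlying natural number. -/
  val : ℕ
  property : val ∈ G.V

instance (G : Dgraph) : Finite G.Vertex :=
  Finite.of_injective (fun v => (⟨v.1, v.2⟩ : {v // v ∈ G.V})) fun _ _ h =>
    Vertex.ext (congrArg Subtype.val h)

instance (G : Dgraph) : Nonempty G.Vertex := G.nonempty.elim fun v hv => ⟨⟨v, hv⟩⟩

/-- The partial order on the vertices of a poset. -/
@[reducible]
def IsPoset.partialOrder {R : Dgraph} (hR : R.IsPoset) : PartialOrder R.Vertex where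
  le v w := (v.1, w.1) ∈ R.A
  le_refl v := hR.1 v.1 v.2
  le_trans u v w := hR.2.2 u.1 v.1 w.1
  le_antisymm v w h₁ h₂ := Vertex.ext (hR.2.1 v.1 w.1 h₁ h₂)

theorem IsPoset.total_of_isPath {R : Dgraph} (hR : R.IsPoset) {p : List ℕ} (hp : R.IsPath p)
    {v w : ℕ} (hv : v ∈ p) (hw : w ∈ p) : (v, w) ∈ R.A ∨ (w, v) ∈ R.A := by
  have htrans : IsTrans ℕ fun v w => (v, w) ∈ R.A := ⟨hR.2.2⟩
  have hsymm : Std.Symm fun v w => (v, w) ∈ R.A ∨ (w, v) ∈ R.A := ⟨fun _ _ => Or.symm⟩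
  have hpw : p.Pairwise fun v w => (v, w) ∈ R.A := List.isChain_iff_pairwise.1 hp.2.2.2
  exact List.Pairwise.forall_of_forall (R := fun v w => (v, w) ∈ R.A ∨ (w, v) ∈ R.A)
    (fun x hx => Or.inl (hR.1 x (hp.2.2.1 x hx))) (hpw.imp Or.inl) hv hw

theorem IsPoset.ncard_flag {R : Dgraph} (hR : R.IsPoset) {n : ℕ}
    (hmax : ∀ P, MaximalPath R P → P.length = n + 1) :
    letI := hR.partialOrder
    ∀ F : Flag R.Vertex, (F : Set R.Vertex).ncard = n + 1 := by
  classical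
  let := hR.partialOrder
  intro F
  have := Fintype.ofFinite F
  let L : List ℕ := ((Finset.univ : Finset F).sort).map fun x => x.1.1
  have hinj : Function.Injective fun x : F => x.1.1 := fun x y h => Subtype.ext (Vertex.ext h)
  have hL : ∀ x : R.Vertex, x.1 ∈ L ↔ x ∈ F := fun x => by
    simp only [L, List.mem_map, Finset.mem_sort, Finset.mem_univ, true_and]
    exact ⟨fun ⟨y, hy⟩ => (Vertex.ext hy : y.1 = x) ▸ y.2, fun hx => ⟨⟨x, hx⟩, rfl⟩⟩
  have hmem : ∀ v ∈ L, v ∈ R.V := fun v hv => by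
    obtain ⟨y, -, rfl⟩ := List.mem_map.1 hv
    exact y.1.2
  have hne : L ≠ [] := by
    obtain ⟨v, hv⟩ := R.nonempty
    have : Nonempty F := by
      by_contra hF
      rw [not_nonempty_iff] at hF
      exact hF.false ⟨⟨v, hv⟩, Flag.mem_iff_forall_le_or_ge.2 fun b hb => (hF.false ⟨b, hb⟩).elim⟩
    obtain ⟨x⟩ := this
    exact List.ne_nil_of_mem ((hL x.1).2 x.2)
  have hpath : R.IsPath L := by
    refine ⟨hne, (Finset.sort_nodup _ _).map hinj, hmem, List.isChain_map_of_isChain _ ?_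
      (Finset.pairwise_sort _ _).isChain⟩
    exact fun _ _ h => h
  rw [← hmax L ⟨hpath, fun Q hQ hLQ v hv => ?_⟩]
  · rw [List.length_map, Finset.length_sort, Finset.card_univ, ← Nat.card_eq_fintype_card]
    rfl
  · refine (hL ⟨v, hQ.2.2.1 v hv⟩).2 (Flag.mem_iff_forall_le_or_ge.2 fun b hb => ?_)
    exact hR.total_of_isPath hQ hv (hLQ b.1 ((hL b).2 hb))

theorem IsPoset.exists_isChainGraded {R : Dgraph} {n : ℕ} (hR : MemC n R) :
    letI := hR.1.partialOrder
    ∃ rk : R.Vertex → ℕ, IsChainGraded n rk := by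
  let := hR.1.partialOrder
  refine _root_.exists_isChainGraded (hR.1.ncard_flag hR.2.1) fun {a b x y} hx hy => ?_
  obtain ⟨q, hq, hqi⟩ := hR.2.2 (a.1, b.1) (hx.1.trans hx.2)
  have hmem : ∀ z : R.Vertex, z ∈ Set.Icc a b → z.1 ∈ q := fun z hz =>
    (hqi z.1).2 (Finset.mem_filter.2 ⟨z.2, hz⟩)
  exact hR.1.total_of_isPath hq (hmem x hx) (hmem y hy)

theorem IsPoset.memTa {G : Dgraph} (hG : G.IsPoset) : G.MemTa := by
  rintro ⟨p, -, hp, hlen, hlast⟩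
  have htrans : IsTrans ℕ fun v w => (v, w) ∈ G.A ∧ v ≠ w :=
    ⟨fun u v w h₁ h₂ => ⟨hG.2.2 u v w h₁.1 h₂.1, fun e => by
      subst e
      exact h₁.2 (hG.2.1 _ _ h₁.1 h₂.1)⟩⟩
  match p, hlen with
  | a :: b :: l, _ =>
    have hpw := List.isChain_iff_pairwise.1 hp
    rw [List.head?_cons, List.getLast?_cons_cons] at hlast
    exact ((List.pairwise_cons.1 hpw).1 a (List.mem_of_getLast? hlast.symm)).2 rfl

section OfOrder

variable (P : Type) [PartialOrder P] [Finite P] [Nonempty P]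

/-- A numbering of a finite type. -/
noncomputable def numbering (P : Type) [Finite P] : P → ℕ := fun x => Finite.equivFin P x

theorem numbering_injective (P : Type) [Finite P] : Function.Injective (numbering P) :=
  Fin.val_injective.comp (Finite.equivFin P).injective

open Classical in
/-- The digraph on natural numbers corresponding to a finite partial order. -/
noncomputable def ofOrder : Dgraph :=
  letI := Fintype.ofFinite P
  { V := Finset.univ.image (numbering P)
    nonempty := Finset.univ_nonempty.image _
    A := ((Finset.univ : Finset (P × P)).filter fun p => p.1 ≤ p.2).image
      (Prod.map (numbering P) (numbering P))
    A_sub := by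
      intro p hp
      obtain ⟨q, -, rfl⟩ := Finset.mem_image.1 hp
      exact ⟨Finset.mem_image_of_mem _ (Finset.mem_univ _),
        Finset.mem_image_of_mem _ (Finset.mem_univ _)⟩ }

variable {P}

theorem mem_V_ofOrder {v : ℕ} : v ∈ (ofOrder P).V ↔ ∃ x, numbering P x = v := by
  simp [ofOrder]

theorem mem_A_ofOrder {p : ℕ × ℕ} :
    p ∈ (ofOrder P).A ↔ ∃ x y : P, x ≤ y ∧ (numbering P x, numbering P y) = p := by
  simp [ofOrder]

variable (P)

theorem isPoset_ofOrder : (ofOrder P).IsPoset := by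
  have hinj := numbering_injective P
  refine ⟨fun v hv => ?_, fun v w hvw hwv => ?_, fun u v w huv hvw => ?_⟩
  · obtain ⟨x, rfl⟩ := mem_V_ofOrder.1 hv
    exact mem_A_ofOrder.2 ⟨x, x, le_rfl, rfl⟩
  · obtain ⟨x, y, hxy, h⟩ := mem_A_ofOrder.1 hvw
    obtain ⟨y', x', hyx, h'⟩ := mem_A_ofOrder.1 hwv
    simp only [Prod.mk.injEq] at h h'
    obtain ⟨rfl, rfl⟩ := h
    obtain rfl := hinj h'.1
    obtain rfl := hinj h'.2
    rw [le_antisymm hxy hyx]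
  · obtain ⟨x, y, hxy, h⟩ := mem_A_ofOrder.1 huv
    obtain ⟨y', z, hyz, h'⟩ := mem_A_ofOrder.1 hvw
    simp only [Prod.mk.injEq] at h h'
    obtain ⟨rfl, rfl⟩ := h
    obtain ⟨h', rfl⟩ := h'
    exact mem_A_ofOrder.2 ⟨x, z, hxy.trans (hinj h' ▸ hyz), rfl⟩

theorem ncard_hom_ofOrder {R : Dgraph} (hR : R.IsPoset) :
    letI := hR.partialOrder
    (Hom (ofOrder P) R).ncard = Nat.card (P →o R.Vertex) := by
  let := hR.partialOrder
  have hinj := numbering_injective P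
  symm
  refine Nat.card_congr (Equiv.ofBijective
    (fun g => ⟨Function.extend (numbering P) (fun x => (g x).1) 0, ?_, ?_, ?_⟩) ⟨?_, ?_⟩)
  · intro v hv
    obtain ⟨x, rfl⟩ := mem_V_ofOrder.1 hv
    rw [hinj.extend_apply]
    exact (g x).2
  · intro p hp
    obtain ⟨x, y, hxy, rfl⟩ := mem_A_ofOrder.1 hp
    simp only [hinj.extend_apply]
    exact g.monotone hxy
  · intro v hv
    exact Function.extend_apply' _ _ _ fun h => hv (mem_V_ofOrder.2 h)
  · intro f g hfg
    refine OrderHom.ext _ _ (funext fun x => Vertex.ext ?_)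
    have := congrFun (congrArg Subtype.val hfg) (numbering P x)
    simpa only [hinj.extend_apply] using this
  · rintro ⟨f, hfV, hfA, hf₀⟩
    refine ⟨⟨fun x => ⟨f (numbering P x), hfV _ (mem_V_ofOrder.2 ⟨x, rfl⟩)⟩, fun x y hxy =>
      hfA _ (mem_A_ofOrder.2 ⟨x, y, hxy, rfl⟩)⟩, Subtype.ext (funext fun v => ?_)⟩
    change Function.extend (numbering P) (fun x => f (numbering P x)) 0 v = f v
    by_cases hv : ∃ x, numbering P x = v
    · obtain ⟨x, rfl⟩ := hv
      exact hinj.extend_apply _ _ _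
    · exact Eq.trans (Function.extend_apply' _ _ _ hv)
        (hf₀ v fun h => hv (mem_V_ofOrder.1 h)).symm

end OfOrder

/-- The arc relation of `G*`. -/
def ProperArc (G : Dgraph) (v w : ℕ) : Prop := (v, w) ∈ G.A ∧ v ≠ w

theorem transGen_properArc_mem {G : Dgraph} {v w : ℕ} (h : Relation.TransGen G.ProperArc v w) :
    v ∈ G.V ∧ w ∈ G.V := by
  induction h with
  | single h => exact G.A_sub _ h.1
  | tail _ h ih => exact ⟨ih.1, (G.A_sub _ h.1).2⟩

theorem MemTa.not_transGen_self {G : Dgraph} (hG : G.MemTa) (a : ℕ) :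
    ¬ Relation.TransGen G.ProperArc a a := fun h => by
  obtain ⟨c, hac, hca⟩ := Relation.TransGen.head'_iff.1 h
  obtain ⟨l, hl, hlast⟩ := List.exists_isChain_cons_of_relationReflTransGen hca
  have hchain : List.IsChain G.ProperArc (a :: c :: l) := List.isChain_cons_cons.2 ⟨hac, hl⟩
  refine hG ⟨a :: c :: l, fun v hv => ?_, hchain, by simp, ?_⟩
  · have hpw : (a :: c :: l).Pairwise (Relation.TransGen G.ProperArc) :=
      List.isChain_iff_pairwise.1 (hchain.imp fun _ _ => Relation.TransGen.single)
    rcases List.mem_cons.1 hv with rfl | hv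
    · exact (transGen_properArc_mem h).1
    · exact (transGen_properArc_mem ((List.pairwise_cons.1 hpw).1 v hv)).2
  · rw [List.head?_cons, List.getLast?_cons_cons, List.getLast?_eq_some_getLast (by simp), hlast]

/-- The transitive hull of a digraph whose proper arcs form no closed walk, as a partial order on
the vertices. -/
@[reducible]
def MemTa.partialOrder {G : Dgraph} (hG : G.MemTa) : PartialOrder G.Vertex where
  le v w := Relation.ReflTransGen G.ProperArc v.1 w.1
  le_refl _ := Relation.ReflTransGen.refl
  le_trans _ _ _ := Relation.ReflTransGen.trans
  le_antisymm v w h₁ h₂ := Vertex.ext <| by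
    rcases Relation.reflTransGen_iff_eq_or_transGen.1 h₁ with h | h
    · exact h.symm
    · exact absurd (h.trans_left h₂) (hG.not_transGen_self _)

theorem MemTa.lt_iff {G : Dgraph} (hG : G.MemTa) {v w : G.Vertex} :
    letI := hG.partialOrder
    v < w ↔ Relation.TransGen G.ProperArc v.1 w.1 := by
  let := hG.partialOrder
  rw [lt_iff_le_and_ne]
  constructor
  · rintro ⟨h, hne⟩
    exact (Relation.reflTransGen_iff_eq_or_transGen.1 h).resolve_left fun e =>
      hne (Vertex.ext e.symm)
  · exact fun h => ⟨h.to_reflTransGen, fun e => hG.not_transGen_self w.1 (e ▸ h)⟩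

theorem ncard_sHom {G R : Dgraph} (hG : G.MemTa) (hR : R.IsPoset) :
    letI := hG.partialOrder
    letI := hR.partialOrder
    (SHom G R).ncard = Nat.card {f : G.Vertex → R.Vertex // StrictMono f} := by
  let := hG.partialOrder
  let := hR.partialOrder
  have hinj : Function.Injective fun x : G.Vertex => x.1 := fun _ _ => Vertex.ext
  have hval : ∀ (g : G.Vertex → R.Vertex) (v : ℕ) (hv : v ∈ G.V),
      Function.extend (fun x : G.Vertex => x.1) (fun x => (g x).1) 0 v = (g ⟨v, hv⟩).1 :=
    fun g v hv => hinj.extend_apply _ _ ⟨v, hv⟩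
  have hnot : ∀ v, v ∉ G.V → ¬ ∃ x : G.Vertex, x.1 = v := fun v hv ⟨x, hx⟩ => hv (hx ▸ x.2)
  have hlt : ∀ {g : G.Vertex → R.Vertex}, StrictMono g → ∀ {p : ℕ × ℕ}
      (hp : p ∈ G.A), p.1 ≠ p.2 → g ⟨p.1, (G.A_sub p hp).1⟩ < g ⟨p.2, (G.A_sub p hp).2⟩ :=
    fun hg p hp hne => hg (hG.lt_iff.2 (Relation.TransGen.single ⟨hp, hne⟩))
  symm
  refine Nat.card_congr (Equiv.ofBijective
    (fun g => ⟨Function.extend (fun x : G.Vertex => x.1) (fun x => (g.1 x).1) 0,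
      ⟨?_, ?_, ?_⟩, ?_⟩) ⟨?_, ?_⟩)
  · intro v hv
    rw [hval _ v hv]
    exact (g.1 _).2
  · intro p hp
    rw [hval _ _ (G.A_sub p hp).1, hval _ _ (G.A_sub p hp).2]
    by_cases hne : p.1 = p.2
    · simp only [hne]
      exact hR.1 _ (g.1 _).2
    · exact (hlt g.2 hp hne).le
  · intro v hv
    exact Function.extend_apply' _ _ _ (hnot v hv)
  · intro p hp
    obtain ⟨hp, hne⟩ := Finset.mem_filter.1 hp
    rw [hval _ _ (G.A_sub p hp).1, hval _ _ (G.A_sub p hp).2]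
    exact fun h => (hlt g.2 hp hne).ne (Vertex.ext h)
  · intro f g hfg
    refine Subtype.ext (funext fun x => Vertex.ext ?_)
    have := congrFun (congrArg Subtype.val hfg) x.1
    simpa only [hinj.extend_apply] using this
  · rintro ⟨f, ⟨hfV, hfA, hf₀⟩, hfs⟩
    refine ⟨⟨fun x => ⟨f x.1, hfV _ x.2⟩, fun x y hxy => ?_⟩, Subtype.ext (funext fun v => ?_)⟩
    · have hgen := hG.lt_iff.1 hxy
      have hstep : ∀ {v w}, G.ProperArc v w → (f v, f w) ∈ R.A ∧ f v ≠ f w := fun h =>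
        ⟨hfA _ h.1, hfs _ (Finset.mem_filter.2 h)⟩
      have key : ∀ {v w : ℕ}, Relation.TransGen G.ProperArc v w →
          (f v, f w) ∈ R.A ∧ f v ≠ f w := fun h => by
        induction h with
        | single h => exact hstep h
        | tail _ h ih =>
          refine ⟨hR.2.2 _ _ _ ih.1 (hstep h).1, fun e => (hstep h).2 ?_⟩
          exact hR.2.1 _ _ (hstep h).1 (e ▸ ih.1)
      exact lt_of_le_of_ne (key hgen).1 fun e => (key hgen).2 (congrArg Vertex.val e)
    · change Function.extend (fun x : G.Vertex => x.1) (fun x => f x.1) 0 v = f v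
      by_cases hv : v ∈ G.V
      · exact hinj.extend_apply _ _ ⟨v, hv⟩
      · exact Eq.trans (Function.extend_apply' _ _ _ (hnot v hv)) (hf₀ v hv).symm

end Dgraph

namespace Dgraph

variable {G : Dgraph} {n : ℕ}

theorem reflTransGen_properArc {v w : ℕ} (h : Relation.TransGen (fun a c => (a, c) ∈ G.A) v w) :
    Relation.ReflTransGen G.ProperArc v w := by
  refine h.to_reflTransGen.lift' id fun a c hac => ?_
  by_cases hne : a = c
  · exact hne ▸ Relation.ReflTransGen.refl
  · exact Relation.ReflTransGen.single ⟨hac, hne⟩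

theorem MemTa.rdArc_of_covBy (hG : G.MemTa) {a c : G.Vertex} :
    letI := hG.partialOrder
    a ⋖ c → RdArc G a.1 c.1 := by
  let := hG.partialOrder
  intro h
  have hno : ∀ d, Relation.TransGen G.ProperArc a.1 d → ¬ Relation.TransGen G.ProperArc d c.1 :=
    fun d had hdc => h.2 (c := ⟨d, (transGen_properArc_mem had).2⟩) (hG.lt_iff.2 had)
      (hG.lt_iff.2 hdc)
  obtain ⟨d, had, hdc⟩ := Relation.TransGen.head'_iff.1 (hG.lt_iff.1 h.1)
  rcases Relation.reflTransGen_iff_eq_or_transGen.1 hdc with hd | hdc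
  · rw [← hd] at had
    refine ⟨had.1, had.2, ?_⟩
    rintro ⟨q, hq, hlen, hhead, hlast⟩
    match q, hlen with
    | x :: y :: z :: l, _ =>
      have hxa : x = a.1 := by simpa using hhead
      subst hxa
      have hpw : (a.1 :: y :: z :: l).Pairwise (Relation.TransGen G.ProperArc) :=
        List.isChain_iff_pairwise.1 (hq.2.2.2.imp fun _ _ h => Relation.TransGen.single h)
      rw [List.getLast?_cons_cons, List.getLast?_cons_cons] at hlast
      have hc := List.mem_of_getLast? hlast
      rw [List.pairwise_cons, List.pairwise_cons] at hpw
      exact hno y (hpw.1 y (by simp)) (hpw.2.1 _ hc)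
  · exact absurd hdc (hno d (.single had))

theorem mem_V_of_mem_Vh {v : ℕ} (hv : v ∈ Vh G) : v ∈ G.V := by
  obtain ⟨p, hp, -, hvp⟩ := hv
  exact hp.2.2.1 v hvp

theorem MemTa.exists_strictMono (hG : G.MemTa) (hn : G.height = n)
    (x : {v : G.Vertex | v.1 ∈ Vh G}) :
    letI := hG.partialOrder
    ∃ p : Fin (n + 1) → {v : G.Vertex | v.1 ∈ Vh G}, StrictMono p ∧ x ∈ Set.range p := by
  let := hG.partialOrder
  obtain ⟨p, hp, hlen, hx⟩ := x.2
  have hmem : ∀ v ∈ p, v ∈ Vh G := fun v hv => ⟨p, hp, hlen, hv⟩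
  rw [hn] at hlen
  have hlt : ∀ i : Fin (n + 1), i.1 < p.length := fun i => hlen.symm ▸ i.2
  have hget : ∀ i, p.get ⟨i.1, hlt i⟩ ∈ p := fun i => List.get_mem _ _
  refine ⟨fun i => ⟨⟨p.get ⟨i.1, hlt i⟩, hp.2.2.1 _ (hget i)⟩, hmem _ (hget i)⟩,
    Fin.strictMono_iff_lt_succ.2 fun i => hG.lt_iff.2 (.single ⟨?_, ?_⟩), ?_⟩
  · exact List.isChain_iff_getElem.1 hp.2.2.2 i.1 (by omega)
  · simp [hp.2.1.getElem_inj_iff]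
  · obtain ⟨i, hi, hix⟩ := List.getElem_of_mem hx
    exact ⟨⟨i, hlen ▸ hi⟩, Subtype.ext (Vertex.ext hix)⟩

theorem isPathx_pair {a c : ℕ} (h : RdArc G a c) : IsPathx G [a, c] := by
  have := G.A_sub _ h.1
  refine ⟨by simp, by simpa using h.2.1, by simpa using this, List.isChain_pair.2 h⟩

theorem IsUpperShell.mem_of_rdArc {a c : ℕ} {U : Set ℕ} (hU : IsUpperShell G a U)
    (ha : a ∉ Vh G) (hc : c ∈ Vh G) (h : RdArc G a c) : c ∈ U := by
  obtain ⟨x, hxU, hx⟩ := hU.2.2 [a, c] (isPathx_pair h) rfl ⟨c, hc, rfl⟩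
  rcases List.mem_pair.1 hx with rfl | rfl
  · exact absurd (hU.1 hxU) ha
  · exact hxU

theorem IsBottomShell.mem_of_rdArc {a c : ℕ} {B : Set ℕ} (hB : IsBottomShell G c B)
    (hc : c ∉ Vh G) (ha : a ∈ Vh G) (h : RdArc G a c) : a ∈ B := by
  obtain ⟨x, hxB, hx⟩ := hB.2.2 [a, c] (isPathx_pair h) ⟨a, ha, rfl⟩ rfl
  rcases List.mem_pair.1 hx with rfl | rfl
  · exact hxB
  · exact absurd (hB.1 hxB) hc

/-- The connectivity component of a vertex outside of all longest paths. -/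
def component (G : Dgraph) (v : ℕ) : Set ℕ :=
  {w | w ∈ Vmh G ∧ Relation.ReflTransGen (adjx G) v w}

theorem component_eq_of_adjx {a c : ℕ} (h : adjx G a c) : component G a = component G c := by
  have h' : adjx G c a := ⟨h.1.symm, h.2.2, h.2.1⟩
  ext w
  exact ⟨fun hw => ⟨hw.1, hw.2.head h'⟩, fun hw => ⟨hw.1, hw.2.head h⟩⟩

theorem exists_intervalCover (hG : MemTaApprox n G) :
    letI := hG.1.partialOrder
    ∃ b u : G.Vertex → {v : G.Vertex | v.1 ∈ Vh G},
      IntervalCover {v : G.Vertex | v.1 ∈ Vh G} b u := by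
  classical
  have hTa := hG.1
  let := hTa.partialOrder
  obtain ⟨B, U, hBU, hZ⟩ := hG.2.2
  choose! b hb u hu hsub using hZ
  have hcomp : ∀ {v}, v ∈ Vmh G → IsComponent G (component G v) := fun hv => ⟨_, hv, rfl⟩
  have hself : ∀ {v}, v ∈ Vmh G → v ∈ component G v := fun hv => ⟨hv, .refl⟩
  have hmh : ∀ {v : G.Vertex}, v ∉ {v : G.Vertex | v.1 ∈ Vh G} → v.1 ∈ Vmh G :=
    fun {v} hv => ⟨v.2, hv⟩
  let toVertex (f : Set ℕ → ℕ) (hf : ∀ Z, IsComponent G Z → f Z ∈ Vh G) (v : G.Vertex) :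
      {v : G.Vertex | v.1 ∈ Vh G} :=
    if hv : v.1 ∈ Vh G then ⟨v, hv⟩ else
      have hfv := hf _ (hcomp (hmh hv))
      ⟨⟨f (component G v.1), mem_V_of_mem_Vh hfv⟩, hfv⟩
  have htoVertex : ∀ {f hf} {v : G.Vertex}, v.1 ∉ Vh G →
      (toVertex f hf v).1.1 = f (component G v.1) := fun hv => by
    simp only [toVertex, dif_neg hv]
  have hIcc : ∀ {v w : G.Vertex}, v.1 ∉ Vh G →
      w.1 ∈ trInterval G (b (component G v.1)) (u (component G v.1)) →
      w ∈ Set.Icc (toVertex b hb v : G.Vertex) (toVertex u hu v) := fun {v w} hv hw => by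
    constructor
    · change Relation.ReflTransGen G.ProperArc _ _
      rw [htoVertex hv]
      exact reflTransGen_properArc hw.1
    · change Relation.ReflTransGen G.ProperArc _ _
      rw [htoVertex hv]
      exact reflTransGen_properArc hw.2
  refine ⟨toVertex b hb, toVertex u hu, fun {z} hz => ?_, fun {a c} hac ha hc => ?_,
    fun {a c} hac ha hc => ?_, fun {a c} hac ha hc => ?_⟩
  · exact hIcc hz (hsub _ (hcomp (hmh hz)) (.inl (.inr (hself (hmh hz)))))
  · have e := component_eq_of_adjx ⟨.inl (hTa.rdArc_of_covBy hac), hmh ha, hmh hc⟩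
    constructor <;> refine Subtype.ext (Vertex.ext ?_) <;> rw [htoVertex ha, htoVertex hc, e]
  · exact hIcc ha (hsub _ (hcomp (hmh ha)) (.inr (Set.mem_biUnion (hself (hmh ha))
      ((hBU _ (hmh ha)).2.mem_of_rdArc ha hc (hTa.rdArc_of_covBy hac)))))
  · exact hIcc hc (hsub _ (hcomp (hmh hc)) (.inl (.inl (Set.mem_biUnion (hself (hmh hc))
      ((hBU _ (hmh hc)).1.mem_of_rdArc hc ha (hTa.rdArc_of_covBy hac))))))

theorem ncard_sHom_le {R S : Dgraph} (hR : MemC n R) (hS : MemC n S)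
    (h : ∀ P : Dgraph, P.IsPoset → (Hom P R).ncard ≤ (Hom P S).ncard) (hG : MemTaApprox n G) :
    (SHom G R).ncard ≤ (SHom G S).ncard := by
  let := hG.1.partialOrder
  let := hR.1.partialOrder
  let := hS.1.partialOrder
  obtain ⟨rkR, hrkR⟩ := IsPoset.exists_isChainGraded hR
  obtain ⟨rkS, hrkS⟩ := IsPoset.exists_isChainGraded hS
  obtain ⟨b, u, hX⟩ := exists_intervalCover hG
  rw [ncard_sHom hG.1 hR.1, ncard_sHom hG.1 hS.1]
  refine hX.card_strictMono_le hrkR hrkS (fun P _ _ _ => ?_) (hG.1.exists_strictMono hG.2.1)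
  rw [← ncard_hom_ofOrder P hR.1, ← ncard_hom_ofOrder P hS.1]
  exact h _ (isPoset_ofOrder P)

end Dgraph

theorem stmt_3 (n : ℕ) (R S : Dgraph) (hR : MemC n R) (hS : MemC n S) :
    ((∀ G : Dgraph, G.MemTa → (Hom G R).ncard ≤ (Hom G S).ncard) →
      ∀ G : Dgraph, MemTaApprox n G → (SHom G R).ncard ≤ (SHom G S).ncard) ∧
    ((∀ G : Dgraph, G.IsPoset → (Hom G R).ncard ≤ (Hom G S).ncard) →
      ∀ G : Dgraph, MemTaApprox n G → G.IsPoset →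
        (SHom G R).ncard ≤ (SHom G S).ncard) :=
  ⟨fun h _ hG => ncard_sHom_le hR hS (fun P hP => h P hP.memTa) hG,
    fun h _ hG _ => ncard_sHom_le hR hS h hG⟩
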